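/- arXiv:2211.05266 — 5 statements merged into one kernel-verified Lean document; each statement's English description precedes it below -/
import Mathlib

section
/- Suppose (g_1,…,g_{n-1}) is strongly monotone on B. Then for every index i ∈ {1,…,n} and every c ∈ [a_i, b_i], there is at most one point p ∈ B with p_i = c and g_1(p) = ⋯ = g_{n-1}(p) = 0; that is, every hyperplane x_i = c intersects S ∩ B in at most one point. -/
/-- The partial derivative `∂f/∂x_i` at `p`. -/
noncomputable def pd {m : ℕ} (f : (Fin m → ℝ) → ℝ) (i : Fin m) (p : Fin m → ℝ) : ℝ :=
  fderiv ℝ f p (Pi.single i 1)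

/-- `f` is continuously differentiable on an open set containing `B`. -/
def C1On {m : ℕ} (f : (Fin m → ℝ) → ℝ) (B : Set (Fin m → ℝ)) : Prop :=
  ∃ U : Set (Fin m → ℝ), IsOpen U ∧ B ⊆ U ∧ ContDiffOn ℝ 1 f U

/-- `M` is an admissible `i`-minor of the family `g = (g_1, …, g_{n+1})` of
functions on `ℝ^{n+2}` over `B`: there are points `q j ∈ B` with
`M j k = (∂ g_j / ∂ x_{c k})(q j)`, where `c = i.succAbove` is the increasing
enumeration of the complement of `{i}` in `Fin (n+2)`. -/
def AdmMinor (n : ℕ) (g : Fin (n+1) → (Fin (n+2) → ℝ) → ℝ) (B : Set (Fin (n+2) → ℝ))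
    (i : Fin (n+2)) (M : Matrix (Fin (n+1)) (Fin (n+1)) ℝ) : Prop :=
  ∃ q : Fin (n+1) → (Fin (n+2) → ℝ), (∀ j, q j ∈ B) ∧
    ∀ j k, M j k = pd (g j) (i.succAbove k) (q j)

/-- The family `(g_1, …, g_{n+1})` is strongly monotone on `B`: every admissible
`i`-minor over `B` has nonzero determinant, for every `i`. -/
def StrongMono (n : ℕ) (g : Fin (n+1) → (Fin (n+2) → ℝ) → ℝ)
    (B : Set (Fin (n+2) → ℝ)) : Prop :=
  ∀ (i : Fin (n+2)) (M : Matrix (Fin (n+1)) (Fin (n+1)) ℝ), AdmMinor n g B i M → M.det ≠ 0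

theorem C1On.differentiableAt {m : ℕ} {f : (Fin m → ℝ) → ℝ} {B : Set (Fin m → ℝ)}
    (hf : C1On f B) {x : Fin m → ℝ} (hx : x ∈ B) : DifferentiableAt ℝ f x := by
  obtain ⟨U, hU, hBU, hfU⟩ := hf
  exact (hfU.differentiableOn one_ne_zero).differentiableAt (hU.mem_nhds (hBU hx))

theorem fderiv_apply_eq_sum_pd {m : ℕ} (f : (Fin m → ℝ) → ℝ) (x v : Fin m → ℝ) :
    fderiv ℝ f x v = ∑ k, pd f k x * v k := by
  conv_lhs => rw [pi_eq_sum_univ' v]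
  simp only [map_sum, map_smul, smul_eq_mul, pd]
  exact Finset.sum_congr rfl fun k _ => mul_comm _ _

/-- The mean value theorem on a convex set, in terms of partial derivatives. -/
theorem C1On.exists_sub_eq_sum_pd {m : ℕ} {f : (Fin m → ℝ) → ℝ} {B : Set (Fin m → ℝ)}
    (hf : C1On f B) (hB : Convex ℝ B) {p q : Fin m → ℝ} (hp : p ∈ B) (hq : q ∈ B) :
    ∃ r ∈ B, f q - f p = ∑ k, pd f k r * (q - p) k := by
  obtain ⟨r, hr, h⟩ := domain_mvt
    (fun x hx => (hf.differentiableAt hx).hasFDerivAt.hasFDerivWithinAt) hB hp hq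
  exact ⟨r, hB.segment_subset hp hq hr, by rw [h, fderiv_apply_eq_sum_pd]⟩

/-- If `(g_1,…,g_{n-1})` is strongly monotone on the box `B`, then every
hyperplane `x_i = c` (with `c ∈ [a i, b i]`) meets `S ∩ B` in at most one point. -/
theorem hyperplane_inter_at_most_one (n : ℕ) (a b : Fin (n+2) → ℝ)
    (hab : ∀ i, a i < b i) (g : Fin (n+1) → (Fin (n+2) → ℝ) → ℝ)
    (hC1 : ∀ j, C1On (g j) (Set.Icc a b))
    (hSM : StrongMono n g (Set.Icc a b)) :
    ∀ i : Fin (n+2), ∀ c ∈ Set.Icc (a i) (b i),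
      ∀ p q : Fin (n+2) → ℝ, p ∈ Set.Icc a b → q ∈ Set.Icc a b →
        p i = c → q i = c →
        (∀ j, g j p = 0) → (∀ j, g j q = 0) → p = q := by
  intro i c _ p q hp hq hpi hqi hgp hgq
  choose r hr hmvt using fun j => (hC1 j).exists_sub_eq_sum_pd (convex_Icc a b) hp hq
  let M : Matrix (Fin (n+1)) (Fin (n+1)) ℝ :=
    Matrix.of fun j k => pd (g j) (i.succAbove k) (r j)
  have hdet : M.det ≠ 0 := hSM i M ⟨r, hr, fun _ _ => rfl⟩
  have hker : M.mulVec (fun k => (q - p) (i.succAbove k)) = 0 := by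
    ext j
    have h := hmvt j
    rw [hgp, hgq, Fin.sum_univ_succAbove _ i] at h
    simpa [Matrix.mulVec, dotProduct, M, hpi, hqi] using h.symm
  have hzero := Matrix.eq_zero_of_mulVec_eq_zero hdet hker
  ext k
  obtain rfl | ⟨k, rfl⟩ := i.eq_self_or_eq_succAbove k
  · rw [hpi, hqi]
  · exact (sub_eq_zero.mp (congrFun hzero k)).symm
end

section
/- Suppose (g_1,…,g_{n-1}) is strongly monotone on B. Then B contains at most one connected component of S: the set S ∩ B is preconnected (possibly empty). -/
open Filter Topology Matrix

/-- Cramer's rule for a kernel vector of an `m × (m+1)` matrix. -/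
theorem kernel_apply_mul_det {m : ℕ} (A : Matrix (Fin m) (Fin (m+1)) ℝ) (v : Fin (m+1) → ℝ)
    (hv : A *ᵥ v = 0) (i : Fin (m+1)) :
    v i * (A.submatrix id (Fin.succAbove 0)).det =
      (-1) ^ (i : ℕ) * (A.submatrix id i.succAbove).det * v 0 := by
  set N : Matrix (Fin (m+1)) (Fin (m+1)) ℝ := Matrix.of (Fin.cons (Pi.single i 1) A)
  have hN0 : ∀ c, N 0 c = Pi.single (M := fun _ => ℝ) i 1 c := fun _ => rfl
  have hNs : ∀ r c, N (Fin.succ r) c = A r c := fun _ _ => rfl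
  have hNv : N *ᵥ v = Pi.single 0 (v i) := by
    ext j
    refine Fin.cases ?_ (fun j => ?_) j
    · simp [Matrix.mulVec, dotProduct, hN0, Pi.single_apply]
    · simpa [Matrix.mulVec, dotProduct, hNs] using congrFun hv j
  have hsub : ∀ k : Fin (m+1), N.submatrix (Fin.succAbove 0) k.succAbove =
      A.submatrix id k.succAbove := by
    intro k
    ext r c
    simp [hNs]
  have hdet : N.det = (-1) ^ (i : ℕ) * (A.submatrix id i.succAbove).det := by
    rw [Matrix.det_succ_row_zero, Finset.sum_eq_single i]
    · have := hsub i
      rw [Fin.succAbove_zero] at this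
      simp [this, hN0]
    · intro k _ hk
      simp [hN0, hk]
    · simp
  have h : N.adjugate *ᵥ (N *ᵥ v) = N.det • v := by
    rw [Matrix.mulVec_mulVec, Matrix.adjugate_mul, Matrix.smul_mulVec, Matrix.one_mulVec]
  have h0 := congrFun h 0
  rw [hNv, Matrix.mulVec_single, hdet] at h0
  simp only [Pi.smul_apply, Matrix.col_apply, smul_eq_mul, MulOpposite.smul_eq_mul_unop,
    MulOpposite.unop_op, Matrix.adjugate_fin_succ_eq_det_submatrix, hsub] at h0
  simp at h0 ⊢
  linarith

/-- The matrix whose `j`-th row is the gradient of `g j` at `q j`. -/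
noncomputable def mixedJacobian {m k : ℕ} (g : Fin k → (Fin m → ℝ) → ℝ)
    (q : Fin k → Fin m → ℝ) : Matrix (Fin k) (Fin m) ℝ :=
  Matrix.of fun j i => pd (g j) i (q j)

theorem mixedJacobian_mulVec {m k : ℕ} (g : Fin k → (Fin m → ℝ) → ℝ)
    (q : Fin k → Fin m → ℝ) (v : Fin m → ℝ) :
    mixedJacobian g q *ᵥ v = fun j => fderiv ℝ (g j) (q j) v := by
  ext j
  refine Eq.trans ?_ (LinearMap.pi_apply_eq_sum_univ
    (fderiv ℝ (g j) (q j) : (Fin m → ℝ) →ₗ[ℝ] ℝ) v).symm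
  simp only [Matrix.mulVec, dotProduct]
  refine Finset.sum_congr rfl fun i _ => ?_
  have he : (Pi.single i 1 : Fin m → ℝ) = fun l => if i = l then 1 else 0 := by
    ext l
    simp [Pi.single_apply, eq_comm]
  simp [mixedJacobian, pd, he, mul_comm (v i)]

/-- The minor of the mixed Jacobian of `g` at `q` obtained by deleting the `i`-th column. -/
noncomputable def mixedMinor {n : ℕ} (g : Fin (n+1) → (Fin (n+2) → ℝ) → ℝ) (i : Fin (n+2))
    (q : Fin (n+1) → Fin (n+2) → ℝ) : ℝ :=
  ((mixedJacobian g q).submatrix id i.succAbove).det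

theorem StrongMono.mixedMinor_ne_zero {n : ℕ} {g : Fin (n+1) → (Fin (n+2) → ℝ) → ℝ}
    {B : Set (Fin (n+2) → ℝ)} (h : StrongMono n g B) (i : Fin (n+2))
    {q : Fin (n+1) → Fin (n+2) → ℝ} (hq : ∀ j, q j ∈ B) : mixedMinor g i q ≠ 0 :=
  h i _ ⟨q, hq, fun _ _ => rfl⟩

theorem C1On.continuousOn_pd {m : ℕ} {f : (Fin m → ℝ) → ℝ} {B : Set (Fin m → ℝ)}
    (h : C1On f B) (i : Fin m) : ContinuousOn (pd f i) B := by
  obtain ⟨U, hU, hBU, hf⟩ := h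
  exact ((hf.continuousOn_fderiv_of_isOpen hU le_rfl).mono hBU).clm_apply continuousOn_const

theorem C1On.hasStrictFDerivAt {m : ℕ} {f : (Fin m → ℝ) → ℝ} {B : Set (Fin m → ℝ)}
    (h : C1On f B) {x : Fin m → ℝ} (hx : x ∈ B) : HasStrictFDerivAt f (fderiv ℝ f x) x := by
  obtain ⟨U, hU, hBU, hf⟩ := h
  exact (hf.contDiffAt (hU.mem_nhds (hBU hx))).hasStrictFDerivAt one_ne_zero

/-- Over a convex set, each mixed minor of a strongly monotone family has constant sign. -/
theorem StrongMono.mixedMinor_mul_pos {n : ℕ} {g : Fin (n+1) → (Fin (n+2) → ℝ) → ℝ}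
    {B : Set (Fin (n+2) → ℝ)} (h : StrongMono n g B) (hB : Convex ℝ B)
    (hC1 : ∀ j, C1On (g j) B) (i : Fin (n+2))
    {q r : Fin (n+1) → Fin (n+2) → ℝ} (hq : ∀ j, q j ∈ B) (hr : ∀ j, r j ∈ B) :
    0 < mixedMinor g i q * mixedMinor g i r := by
  have hconn : IsPreconnected (Set.univ.pi fun _ : Fin (n+1) => B) :=
    isPreconnected_univ_pi fun _ => hB.isPreconnected
  have hcont : ContinuousOn (mixedMinor g i) (Set.univ.pi fun _ : Fin (n+1) => B) := by
    refine (Continuous.matrix_det continuous_id).comp_continuousOn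
      (continuousOn_pi.2 fun j => continuousOn_pi.2 fun k => ?_)
    exact ((hC1 j).continuousOn_pd (i.succAbove k)).comp
      (continuous_apply j).continuousOn fun x hx => hx j trivial
  by_contra! hle
  have key : ∀ s t : Fin (n+1) → Fin (n+2) → ℝ, (∀ j, s j ∈ B) → (∀ j, t j ∈ B) →
      mixedMinor g i s ≤ 0 → 0 ≤ mixedMinor g i t → False := by
    intro s t hs ht hs0 ht0
    obtain ⟨z, hz, hz0⟩ := hconn.intermediate_value (fun j _ => hs j) (fun j _ => ht j) hcont
      ⟨hs0, ht0⟩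
    exact h.mixedMinor_ne_zero i (fun j => hz j trivial) hz0
  rcases mul_nonpos_iff.1 hle with ⟨h1, h2⟩ | ⟨h1, h2⟩
  · exact key r q hr hq h2 h1
  · exact key q r hq hr h1 h2

/-- The mean value theorem applied to each function of a family separately. -/
theorem exists_mixedJacobian_mulVec_sub {m k : ℕ} {g : Fin k → (Fin m → ℝ) → ℝ}
    {B : Set (Fin m → ℝ)} (hB : Convex ℝ B) (hC1 : ∀ j, C1On (g j) B) {x y : Fin m → ℝ}
    (hx : x ∈ B) (hy : y ∈ B) :
    ∃ q : Fin k → Fin m → ℝ, (∀ j, q j ∈ B) ∧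
      mixedJacobian g q *ᵥ (y - x) = fun j => g j y - g j x := by
  have h : ∀ j, ∃ z ∈ B, g j y - g j x = fderiv ℝ (g j) z (y - x) := by
    intro j
    obtain ⟨z, hz, h⟩ := domain_mvt (s := B)
      (fun z hz => ((hC1 j).hasStrictFDerivAt hz).hasFDerivAt.hasFDerivWithinAt) hB hx hy
    exact ⟨z, hB.segment_subset hx hy hz, h⟩
  choose q hq h using h
  exact ⟨q, hq, by rw [mixedJacobian_mulVec]; ext j; exact (h j).symm⟩

/-- If the Jacobian has a nonzero minor complementary to the first coordinate, the zero set
is locally a curve parametrized by the first coordinate. -/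
theorem exists_curve {n : ℕ} {g : Fin (n+1) → (Fin (n+2) → ℝ) → ℝ} {p : Fin (n+2) → ℝ}
    (hg : ∀ j, HasStrictFDerivAt (g j) (fderiv ℝ (g j) p) p) (hp : ∀ j, g j p = 0)
    (hdet : mixedMinor g 0 (fun _ => p) ≠ 0) :
    ∃ (γ : ℝ → Fin (n+2) → ℝ) (w : Fin (n+2) → ℝ), HasDerivAt γ w 0 ∧ γ 0 = p ∧ w 0 = 1 ∧
      mixedJacobian g (fun _ => p) *ᵥ w = 0 ∧
      ∀ᶠ t in 𝓝 (0 : ℝ), γ t 0 = p 0 + t ∧ ∀ j, g j (γ t) = 0 := by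
  let Φ : (Fin (n+2) → ℝ) → Fin (n+2) → ℝ := fun x => Fin.cons (x 0) fun j => g j x
  let L : (Fin (n+2) → ℝ) →L[ℝ] (Fin (n+2) → ℝ) :=
    ContinuousLinearMap.pi
      (Fin.cons (ContinuousLinearMap.proj 0) fun j => fderiv ℝ (g j) p :
        Fin (n+2) → (Fin (n+2) → ℝ) →L[ℝ] ℝ)
  have hL0 : ∀ v, L v 0 = v 0 := fun v => rfl
  have hLs : ∀ v (j : Fin (n+1)), L v j.succ = fderiv ℝ (g j) p v := fun v j => rfl
  have hΦ : HasStrictFDerivAt Φ L p := by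
    refine hasStrictFDerivAt_pi'.2 fun j => ?_
    refine Fin.cases ?_ (fun j => ?_) j
    · exact (ContinuousLinearMap.proj (R := ℝ) (φ := fun _ : Fin (n+2) => ℝ) 0).hasStrictFDerivAt
    · exact hg j
  have hinj : Function.Injective (L : (Fin (n+2) → ℝ) →ₗ[ℝ] (Fin (n+2) → ℝ)) := by
    refine (injective_iff_map_eq_zero _).2 fun v hv => ?_
    have hv' : L v = 0 := hv
    have hker : mixedJacobian g (fun _ => p) *ᵥ v = 0 := by
      rw [mixedJacobian_mulVec]
      ext j
      rw [← hLs, hv']; rfl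
    ext i
    have h0 : v 0 = 0 := by rw [← hL0 v, hv']; rfl
    have := kernel_apply_mul_det _ v hker i
    rw [h0, mul_zero] at this
    exact (mul_eq_zero.1 this).resolve_right hdet
  let e : (Fin (n+2) → ℝ) ≃L[ℝ] (Fin (n+2) → ℝ) :=
    (LinearEquiv.ofInjectiveEndo _ hinj).toContinuousLinearEquiv
  have he : ∀ v, e v = L v := fun v => rfl
  have hΦe : HasStrictFDerivAt Φ (e : (Fin (n+2) → ℝ) →L[ℝ] (Fin (n+2) → ℝ)) p := hΦ
  let E : Fin (n+2) → ℝ := Pi.single 0 1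
  have hLE : L (e.symm E) = E := by rw [← he]; exact e.apply_symm_apply E
  have hline : HasDerivAt (fun t : ℝ => Φ p + t • E) E 0 := by
    simpa using ((hasDerivAt_id (0 : ℝ)).smul_const E).const_add (Φ p)
  have hline0 : Φ p + (0 : ℝ) • E = Φ p := by simp
  refine ⟨fun t => hΦe.localInverse Φ e p (Φ p + t • E), e.symm E, ?_, ?_, ?_, ?_, ?_⟩
  · refine HasFDerivAt.comp_hasDerivAt (f := fun t : ℝ => Φ p + t • E)
      (l := hΦe.localInverse Φ e p)
      (l' := (e.symm : (Fin (n+2) → ℝ) →L[ℝ] (Fin (n+2) → ℝ))) (0 : ℝ) ?_ hline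
    rw [hline0]
    exact hΦe.to_localInverse.hasFDerivAt
  · simp only [hline0]
    exact hΦe.localInverse_apply_image
  · rw [← hL0 (e.symm E), hLE]; simp [E]
  · rw [mixedJacobian_mulVec]
    ext j
    rw [← hLs, hLE]; simp [E]
  · have htend : Tendsto (fun t : ℝ => Φ p + t • E) (𝓝 0) (𝓝 (Φ p)) := by
      simpa only [hline0] using hline.continuousAt.tendsto
    filter_upwards [htend.eventually hΦe.eventually_right_inverse] with t ht
    refine ⟨?_, fun j => ?_⟩
    · have := congrFun ht 0
      simpa [Φ, E] using this
    · have := congrFun ht j.succ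
      simpa [Φ, E, hp] using this

theorem HasDerivAt.eventually_mem_uIcc {f : ℝ → ℝ} {f' c : ℝ} (hf : HasDerivAt f f' 0)
    (hc : 0 < (c - f 0) * f') : ∀ᶠ t in 𝓝[>] (0 : ℝ), f t ∈ Set.uIcc (f 0) c := by
  have hslope : ∀ᶠ t in 𝓝[>] (0 : ℝ), 0 < f' * slope f 0 t := by
    have := (hasDerivAt_iff_tendsto_slope.1 hf).mono_left
      (nhdsWithin_mono (0 : ℝ) fun t (ht : 0 < t) => ht.ne')
    refine (this.const_mul f').eventually (lt_mem_nhds ?_)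
    exact mul_self_pos.2 (right_ne_zero_of_mul hc.ne')
  have hcont : Tendsto f (𝓝[>] 0) (𝓝 (f 0)) := hf.continuousAt.tendsto.mono_left nhdsWithin_le_nhds
  rcases pos_and_pos_or_neg_and_neg_of_mul_pos hc with ⟨h1, h2⟩ | ⟨h1, h2⟩
  · filter_upwards [hslope, hcont.eventually (gt_mem_nhds (sub_pos.1 h1)), self_mem_nhdsWithin]
      with t hs ht ht0
    have hs' := pos_of_mul_pos_right hs h2.le
    rw [slope_def_field, sub_zero] at hs'
    have := (div_pos_iff_of_pos_right ht0).1 hs'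
    exact Set.mem_uIcc.2 (Or.inl ⟨by linarith, ht.le⟩)
  · filter_upwards [hslope, hcont.eventually (lt_mem_nhds (sub_neg.1 h1)), self_mem_nhdsWithin]
      with t hs ht ht0
    have hs' := neg_of_mul_pos_right hs h2.le
    rw [slope_def_field, sub_zero] at hs'
    have := (div_neg_iff.1 hs').resolve_left fun h => absurd h.2 (not_lt.2 (le_of_lt ht0))
    exact Set.mem_uIcc.2 (Or.inr ⟨ht.le, by linarith [this.1]⟩)

/-- If `(g_1,…,g_{n-1})` is strongly monotone on `B`, then `B` contains at most
one connected component of `S`: the set `S ∩ B` is preconnected. -/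
theorem inter_preconnected_of_strongMono (n : ℕ) (a b : Fin (n+2) → ℝ)
    (hab : ∀ i, a i < b i) (g : Fin (n+1) → (Fin (n+2) → ℝ) → ℝ)
    (hC1 : ∀ j, C1On (g j) (Set.Icc a b))
    (hSM : StrongMono n g (Set.Icc a b)) :
    IsPreconnected ({x | ∀ j, g j x = 0} ∩ Set.Icc a b) := by
  set B := Set.Icc a b
  set K := {x | ∀ j, g j x = 0} ∩ B with hK
  have hB : Convex ℝ B := convex_Icc a b
  have hchord : ∀ p ∈ K, ∀ q ∈ K, ∃ r : Fin (n+1) → Fin (n+2) → ℝ, (∀ j, r j ∈ B) ∧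
      mixedJacobian g r *ᵥ (q - p) = 0 := by
    intro p hp q hq
    obtain ⟨r, hr, h⟩ := exists_mixedJacobian_mulVec_sub hB hC1 hp.2 hq.2
    refine ⟨r, hr, h.trans ?_⟩
    ext j
    simp [hp.1 j, hq.1 j]
  have hinj : Set.InjOn (fun x : Fin (n+2) → ℝ => x 0) K := by
    intro p hp q hq hpq
    obtain ⟨r, hr, h⟩ := hchord p hp q hq
    ext i
    have hi := kernel_apply_mul_det _ _ h i
    rw [Pi.sub_apply q p 0, sub_eq_zero.2 (Eq.symm hpq), mul_zero] at hi
    exact (sub_eq_zero.1 ((mul_eq_zero.1 hi).resolve_right (hSM.mixedMinor_ne_zero 0 hr))).symm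
  have hKc : IsCompact K := by
    have hcl : IsClosed K := by
      have : K = ⋂ j, B ∩ g j ⁻¹' {0} := by
        ext x
        simp only [hK, Set.mem_inter_iff, Set.mem_ofPred_eq, Set.mem_iInter, Set.mem_preimage,
          Set.mem_singleton_iff]
        exact ⟨fun h j => ⟨h.2, h.1 j⟩, fun h => ⟨fun j => (h j).2, (h 0).1⟩⟩
      rw [this]
      refine isClosed_iInter fun j => ContinuousOn.preimage_isClosed_of_isClosed
        (fun x hx => ?_) isClosed_Icc isClosed_singleton
      exact ((hC1 j).hasStrictFDerivAt hx).continuousAt.continuousWithinAt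
    exact isCompact_Icc.of_isClosed_subset hcl Set.inter_subset_right
  have hstep : ∀ p ∈ K, ∀ q ∈ K, p 0 < q 0 → ∀ y > p 0, ∃ z ∈ K, z 0 ∈ Set.Ioc (p 0) y := by
    intro p hp q hq hpq y hy
    obtain ⟨r, hr, hrv⟩ := hchord p hp q hq
    have hpB : ∀ _ : Fin (n+1), p ∈ B := fun _ => hp.2
    obtain ⟨γ, w, hγ, hγ0, hw0, hw, hγS⟩ := exists_curve
      (fun j => (hC1 j).hasStrictFDerivAt hp.2) hp.1 (hSM.mixedMinor_ne_zero 0 hpB)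
    have hsign : ∀ i, 0 < (q i - p i) * w i := by
      intro i
      have h1 := kernel_apply_mul_det _ _ hrv i
      have h2 := kernel_apply_mul_det _ _ hw i
      have hD0 := hSM.mixedMinor_mul_pos hB hC1 0 hr hpB
      have hDi := hSM.mixedMinor_mul_pos hB hC1 i hr hpB
      change (q i - p i) * mixedMinor g 0 r = _ * mixedMinor g i r * (q 0 - p 0) at h1
      change w i * mixedMinor g 0 (fun _ => p) = _ * mixedMinor g i (fun _ => p) * w 0 at h2
      have hsq : ((-1 : ℝ) ^ (i : ℕ)) * (-1) ^ (i : ℕ) = 1 := by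
        rw [← mul_pow]; norm_num
      refine pos_of_mul_pos_left (b := mixedMinor g 0 r * mixedMinor g 0 fun _ => p) ?_ hD0.le
      calc 0 < mixedMinor g i r * mixedMinor g i (fun _ => p) * (q 0 - p 0) :=
            mul_pos hDi (sub_pos.2 hpq)
        _ = (((-1 : ℝ) ^ (i : ℕ)) * (-1) ^ (i : ℕ)) *
              (mixedMinor g i r * mixedMinor g i (fun _ => p) * (q 0 - p 0)) := by
            rw [hsq, one_mul]
        _ = ((q i - p i) * mixedMinor g 0 r) * (w i * mixedMinor g 0 (fun _ => p)) := by
            rw [h1, h2, hw0]; ring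
        _ = _ := by ring
    have hbox : ∀ᶠ t in 𝓝[>] (0 : ℝ), ∀ i, γ t i ∈ Set.uIcc (p i) (q i) := by
      refine eventually_all.2 fun i => ?_
      have hγi : HasDerivAt (fun t => γ t i) (w i) 0 := hasDerivAt_pi.1 hγ i
      have := hγi.eventually_mem_uIcc (c := q i) (by simpa only [hγ0] using hsign i)
      simpa only [hγ0] using this
    obtain ⟨t, ⟨⟨ht, hgt⟩, htbox⟩, ht0, hty⟩ :=
      (((hγS.filter_mono nhdsWithin_le_nhds).and hbox).and
        (Ioo_mem_nhdsGT (sub_pos.2 hy))).exists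
    refine ⟨γ t, ⟨hgt, ?_⟩, ?_⟩
    · refine ⟨fun i => ?_, fun i => ?_⟩
      · exact (le_min (hp.2.1 i) (hq.2.1 i)).trans (htbox i).1
      · exact (htbox i).2.trans (max_le (hp.2.2 i) (hq.2.2 i))
    · rw [ht]
      constructor <;> linarith
  have himage : IsPreconnected ((fun x : Fin (n+2) → ℝ => x 0) '' K) := by
    refine Set.OrdConnected.isPreconnected (Set.ordConnected_iff.2 ?_)
    rintro _ ⟨p, hp, rfl⟩ _ ⟨q, hq, rfl⟩ -
    refine IsClosed.Icc_subset_of_forall_exists_gt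
      ((hKc.image (continuous_apply 0)).isClosed.inter isClosed_Icc) ⟨p, hp, rfl⟩ ?_
    rintro _ ⟨⟨x, hx, rfl⟩, -, hxq⟩ y hy
    obtain ⟨z, hz, hzy⟩ := hstep x hx q hq hxq y hy
    exact ⟨z 0, ⟨z, hz, rfl⟩, hzy⟩
  have : CompactSpace K := isCompact_iff_compactSpace.1 hKc
  have hemb : IsClosedEmbedding (K.domRestrict fun x : Fin (n+2) → ℝ => x 0) :=
    Continuous.isClosedEmbedding ((continuous_apply 0).comp continuous_subtype_val)
      (Set.injOn_iff_injective.1 hinj)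
  rw [isPreconnected_iff_preconnectedSpace, preconnectedSpace_iff_univ,
    ← hemb.isInducing.isPreconnected_image, Set.image_univ, Set.range_domRestrict]
  exact himage
end

section
/- Let f : (Fin n → ℝ) → ℝ be C¹ on B and suppose that for every i ∈ {1,…,n} and every p ∈ B, (∂f/∂x_i)(p) ≠ 0. If f(v) > 0 for every vertex v of B, then f(p) > 0 for every p ∈ B; likewise, if f(v) < 0 for every vertex v of B, then f(p) < 0 for every p ∈ B. -/
theorem exists_endpoint_le_of_hasDerivAt_ne_zero {g g' : ℝ → ℝ} {a b t : ℝ}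
    (hg : ∀ s ∈ Set.Icc a b, HasDerivAt g (g' s) s) (hg' : ∀ s ∈ Set.Icc a b, g' s ≠ 0)
    (ht : t ∈ Set.Icc a b) : ∃ s, (s = a ∨ s = b) ∧ g s ≤ g t := by
  obtain ⟨s, hs, hmin⟩ := isCompact_Icc.exists_isMinOn ⟨t, ht⟩
    (fun s hs => (hg s hs).continuousAt.continuousWithinAt)
  refine ⟨s, ?_, hmin ht⟩
  by_contra! h
  have hloc : IsLocalMin g s :=
    hmin.isLocalMin (Icc_mem_nhds (lt_of_le_of_ne hs.1 h.1.symm) (lt_of_le_of_ne hs.2 h.2))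
  exact hg' s hs (hloc.hasDerivAt_eq_zero (hg s hs))

theorem exists_update_endpoint_le {m : ℕ} {a b : Fin m → ℝ} {f : (Fin m → ℝ) → ℝ}
    (hf : ∀ p ∈ Set.Icc a b, DifferentiableAt ℝ f p) {i : Fin m}
    (hd : ∀ p ∈ Set.Icc a b, pd f i p ≠ 0) {p : Fin m → ℝ} (hp : p ∈ Set.Icc a b) :
    ∃ s, (s = a i ∨ s = b i) ∧ f (Function.update p i s) ≤ f p := by
  have hmem : ∀ s ∈ Set.Icc (a i) (b i), Function.update p i s ∈ Set.Icc a b := fun s hs =>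
    ⟨le_update_iff.2 ⟨hs.1, fun j _ => hp.1 j⟩, update_le_iff.2 ⟨hs.2, fun j _ => hp.2 j⟩⟩
  have key := exists_endpoint_le_of_hasDerivAt_ne_zero
    (g := fun s => f (Function.update p i s)) (g' := fun s => pd f i (Function.update p i s))
    (fun s hs => (hf _ (hmem s hs)).hasFDerivAt.comp_hasDerivAt s (hasDerivAt_update p i s))
    (fun s hs => hd _ (hmem s hs)) ⟨hp.1 i, hp.2 i⟩
  simpa using key

theorem exists_vertex_le {m : ℕ} {a b : Fin m → ℝ} (hab : a ≤ b) {f : (Fin m → ℝ) → ℝ}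
    (hf : ∀ p ∈ Set.Icc a b, DifferentiableAt ℝ f p)
    (hd : ∀ i, ∀ p ∈ Set.Icc a b, pd f i p ≠ 0) {p : Fin m → ℝ} (hp : p ∈ Set.Icc a b) :
    ∃ v : Fin m → ℝ, (∀ i, v i = a i ∨ v i = b i) ∧ f v ≤ f p := by
  suffices h : ∀ s : Finset (Fin m), ∃ v ∈ Set.Icc a b,
      (∀ i ∈ s, v i = a i ∨ v i = b i) ∧ f v ≤ f p by
    obtain ⟨v, -, hv, hle⟩ := h Finset.univ
    exact ⟨v, fun i => hv i (Finset.mem_univ i), hle⟩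
  intro s
  induction s using Finset.induction_on with
  | empty => exact ⟨p, hp, by simp, le_rfl⟩
  | insert i s _ ih =>
    obtain ⟨v, hv, hvs, hle⟩ := ih
    obtain ⟨t, ht, htle⟩ := exists_update_endpoint_le hf (hd i) hv
    have htI : t ∈ Set.Icc (a i) (b i) := by
      rcases ht with rfl | rfl
      · exact ⟨le_rfl, hab i⟩
      · exact ⟨hab i, le_rfl⟩
    refine ⟨Function.update v i t, ⟨le_update_iff.2 ⟨htI.1, fun j _ => hv.1 j⟩,
      update_le_iff.2 ⟨htI.2, fun j _ => hv.2 j⟩⟩, fun j hj => ?_, htle.trans hle⟩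
    rcases eq_or_ne j i with rfl | hji
    · simpa using ht
    · simpa [hji] using hvs j (Finset.mem_of_mem_insert_of_ne hj hji)

/-- If `f` is C¹ on the box `B`, all its partial derivatives are nonzero on `B`,
and `f` is positive (resp. negative) at every vertex of `B`, then `f` is
positive (resp. negative) on all of `B`. -/
theorem sign_on_box_of_sign_on_vertices (n : ℕ) (a b : Fin (n+1) → ℝ)
    (hab : ∀ i, a i < b i) (f : (Fin (n+1) → ℝ) → ℝ)
    (hC1 : C1On f (Set.Icc a b))
    (hd : ∀ (i : Fin (n+1)), ∀ p ∈ Set.Icc a b, pd f i p ≠ 0) :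
    ((∀ v : Fin (n+1) → ℝ, (∀ i, v i = a i ∨ v i = b i) → f v > 0) →
        ∀ p ∈ Set.Icc a b, f p > 0) ∧
    ((∀ v : Fin (n+1) → ℝ, (∀ i, v i = a i ∨ v i = b i) → f v < 0) →
        ∀ p ∈ Set.Icc a b, f p < 0) := by
  obtain ⟨U, hU, hBU, hfU⟩ := hC1
  have hf : ∀ p ∈ Set.Icc a b, DifferentiableAt ℝ f p := fun p hp =>
    (hfU.contDiffAt (hU.mem_nhds (hBU hp))).differentiableAt one_ne_zero
  have hle : a ≤ b := fun i => (hab i).le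
  refine ⟨fun h p hp => ?_, fun h p hp => ?_⟩
  · obtain ⟨v, hv, hvp⟩ := exists_vertex_le hle hf hd hp
    exact (h v hv).trans_le hvp
  · have hd' : ∀ i, ∀ q ∈ Set.Icc a b, pd (-f) i q ≠ 0 := fun i q hq => by
      simpa [pd, fderiv_neg] using hd i q hq
    obtain ⟨v, hv, hvp⟩ := exists_vertex_le hle (fun q hq => (hf q hq).neg) hd' hp
    exact (neg_le_neg_iff.1 hvp).trans_lt (h v hv)
end

section
/- (Preconditioner, O-M version.) Let Ω ⊆ ℝⁿ be open, F = (f_1,…,f_n) with each f_j : (Fin n → ℝ) → ℝ continuously differentiable on Ω, and let p* ∈ Ω be a simple zero of F, i.e. F(p*) = 0 and det J_F(p*) ≠ 0, where J_F(x) is the Jacobian matrix with (j,k)-entry (∂f_j/∂x_k)(x). Let U be a fixed real n×n O-M matrix. Then there exists δ > 0 such that for every box B = Set.Icc a b with a i < b i for all i, p* ∈ B, B ⊆ Ω, and max_i (b i − a i) < δ, the matrix J_F(m) at the midpoint m = (a+b)/2 of B is invertible and the transformed system G with components G_k(x) = Σ_l (U · J_F(m)⁻¹)_{k,l} · f_l(x)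 is an O-M system on B. -/
/-- `F = (f_1,…,f_n)` (with `n = n'+2`, 0-based indices) is an O-M system on `B`:
(1) the first `n-1` components are strongly monotone on `B`, and (2) for all
indices `i, j`, admissible minors `Mi, Mj` of the first `n-1` components, and
points `p, q ∈ B`, the quantities `(−1)^{i+n}·det Mi·(∂f_n/∂x_i)(p)` and
`(−1)^{j+n}·det Mj·(∂f_n/∂x_j)(q)` have the same (nonzero) sign.  With 0-based
indices the paper's exponent `i+n` becomes `i.val + n' + 1 (mod 2)`. -/
def OMSystem (n : ℕ) (f : Fin (n+2) → (Fin (n+2) → ℝ) → ℝ)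
    (B : Set (Fin (n+2) → ℝ)) : Prop :=
  StrongMono n (fun j : Fin (n+1) => f j.castSucc) B ∧
  ∀ (i j : Fin (n+2)) (Mi Mj : Matrix (Fin (n+1)) (Fin (n+1)) ℝ),
    AdmMinor n (fun j : Fin (n+1) => f j.castSucc) B i Mi →
    AdmMinor n (fun j : Fin (n+1) => f j.castSucc) B j Mj →
    ∀ p q : Fin (n+2) → ℝ, p ∈ B → q ∈ B →
      ((-1 : ℝ) ^ ((i : ℕ) + n + 1) * Mi.det * pd (f (Fin.last (n+1))) i p) *
        ((-1 : ℝ) ^ ((j : ℕ) + n + 1) * Mj.det * pd (f (Fin.last (n+1))) j q) > 0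

/-- `U` is an O-M matrix: with 0-based indices, for all `i, j` the quantities
`(−1)^{i+n}·det U_{(n,i)}·U_{n,i}` and `(−1)^{j+n}·det U_{(n,j)}·U_{n,j}` have
the same (nonzero) sign, where `U_{(n,i)}` deletes the last row and column `i`. -/
def OMMatrix (n : ℕ) (U : Matrix (Fin (n+2)) (Fin (n+2)) ℝ) : Prop :=
  ∀ i j : Fin (n+2),
    ((-1 : ℝ) ^ ((i : ℕ) + n + 1) * (U.submatrix Fin.castSucc i.succAbove).det *
        U (Fin.last (n+1)) i) *
      ((-1 : ℝ) ^ ((j : ℕ) + n + 1) * (U.submatrix Fin.castSucc j.succAbove).det *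
        U (Fin.last (n+1)) j) > 0

open Filter Topology in
theorem continuousAt_pd {m : ℕ} {f : (Fin m → ℝ) → ℝ} {Ω : Set (Fin m → ℝ)} (hΩ : IsOpen Ω)
    (hf : ContDiffOn ℝ 1 f Ω) {x : Fin m → ℝ} (hx : x ∈ Ω) (i : Fin m) :
    ContinuousAt (pd f i) x :=
  ((hf.continuousOn_fderiv_of_isOpen hΩ le_rfl).continuousAt (hΩ.mem_nhds hx)).clm_apply
    continuousAt_const

theorem pd_sum_mul {m : ℕ} {ι : Type*} [Fintype ι] {f : ι → (Fin m → ℝ) → ℝ}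
    {x : Fin m → ℝ} (hf : ∀ l, DifferentiableAt ℝ (f l) x) (c : ι → ℝ) (i : Fin m) :
    pd (fun y => ∑ l, c l * f l y) i x = ∑ l, c l * pd (f l) i x := by
  have h := HasFDerivAt.fun_sum (u := Finset.univ)
    fun l _ => (hf l).hasFDerivAt.const_mul (c l)
  simp [pd, h.fderiv]

/-- The signed product attached to column `i` in the definition of an O-M matrix. -/
def signedMinor (n : ℕ) (i : Fin (n+2)) (V : Matrix (Fin (n+2)) (Fin (n+2)) ℝ) : ℝ :=
  (-1 : ℝ) ^ ((i : ℕ) + n + 1) * (V.submatrix Fin.castSucc i.succAbove).det *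
    V (Fin.last (n+1)) i

theorem continuous_signedMinor (n : ℕ) (i : Fin (n+2)) : Continuous (signedMinor n i) := by
  unfold signedMinor
  fun_prop

open Filter Topology in
theorem OMMatrix.eventually_signedMinor_mul_pos {n : ℕ}
    {U : Matrix (Fin (n+2)) (Fin (n+2)) ℝ} (hU : OMMatrix n U) :
    ∀ᶠ V in 𝓝 U, ∀ i, 0 < signedMinor n i V * signedMinor n 0 U :=
  eventually_all.2 fun i =>
    ((continuous_signedMinor n i).mul continuous_const).continuousAt.eventually
      (lt_mem_nhds (hU i 0))

/-- A system is O-M on a nonempty set as soon as every matrix obtained by evaluating the rows of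
its Jacobian at (possibly different) points of that set has signed products of the sign of `s`. -/
theorem OMSystem.of_signedMinor {n : ℕ} {g : Fin (n+2) → (Fin (n+2) → ℝ) → ℝ}
    {B : Set (Fin (n+2) → ℝ)} (hB : B.Nonempty) {s : ℝ}
    (h : ∀ q : Fin (n+2) → (Fin (n+2) → ℝ), (∀ k, q k ∈ B) → ∀ i,
      0 < signedMinor n i (Matrix.of fun k c => pd (g k) c (q k)) * s) :
    OMSystem n g B := by
  have key : ∀ i M, AdmMinor n (fun j : Fin (n+1) => g j.castSucc) B i M → ∀ x ∈ B,
      0 < ((-1 : ℝ) ^ ((i : ℕ) + n + 1) * M.det * pd (g (Fin.last (n+1))) i x) * s := by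
    rintro i M ⟨q, hq, hM⟩ x hx
    have := h (Fin.snoc q x) (Fin.lastCases (by simpa using hx) fun k => by simpa using hq k) i
    have hM' : M = (Matrix.of fun k c =>
        pd (g k) c ((Fin.snoc q x : Fin (n+2) → (Fin (n+2) → ℝ)) k)).submatrix
          Fin.castSucc i.succAbove := by
      ext j k
      simp [hM]
    have hx' : pd (g (Fin.last (n+1))) i x =
        pd (g (Fin.last (n+1))) i
          ((Fin.snoc q x : Fin (n+2) → (Fin (n+2) → ℝ)) (Fin.last (n+1))) := by
      simp
    rw [hM', hx']
    exact this
  refine ⟨fun i M hM h0 => ?_, fun i j Mi Mj hi hj x y hx hy => ?_⟩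
  · obtain ⟨x, hx⟩ := hB
    simpa [h0] using key i M hM x hx
  · have hs := mul_pos (key i Mi hi x hx) (key j Mj hj y hy)
    rw [mul_mul_mul_comm] at hs
    exact pos_of_mul_pos_left hs (mul_self_nonneg s)

open Filter Topology in
/-- Preconditioner, O-M version: near a simple zero `p` of `F`, for every small
enough box `B ∋ p` the system `G = U · J_F(m(B))⁻¹ · F` is an O-M system on `B`. -/
theorem preconditioner_OM (n : ℕ) (Ω : Set (Fin (n+2) → ℝ)) (hΩ : IsOpen Ω)
    (f : Fin (n+2) → (Fin (n+2) → ℝ) → ℝ)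
    (hC1 : ∀ j, ContDiffOn ℝ 1 (f j) Ω)
    (p : Fin (n+2) → ℝ) (hp : p ∈ Ω) (hzero : ∀ j, f j p = 0)
    (hsimple : (Matrix.of fun j k : Fin (n+2) => pd (f j) k p).det ≠ 0)
    (U : Matrix (Fin (n+2)) (Fin (n+2)) ℝ) (hU : OMMatrix n U) :
    ∃ δ > 0, ∀ a b : Fin (n+2) → ℝ, (∀ i, a i < b i) →
      p ∈ Set.Icc a b → Set.Icc a b ⊆ Ω → (∀ i, b i - a i < δ) →
      IsUnit (Matrix.of fun j k : Fin (n+2) => pd (f j) k (fun i => (a i + b i) / 2)) ∧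
      OMSystem n
        (fun k x => ∑ l,
          (U * (Matrix.of fun j k' : Fin (n+2) =>
              pd (f j) k' (fun i => (a i + b i) / 2))⁻¹) k l * f l x)
        (Set.Icc a b) := by
  let J : (Fin (n+2) → ℝ) → Matrix (Fin (n+2)) (Fin (n+2)) ℝ :=
    fun x => Matrix.of fun j k => pd (f j) k x
  have hJc : ContinuousAt J p :=
    continuousAt_pi.2 fun j => continuousAt_pi.2 fun k => continuousAt_pd hΩ (hC1 j) hp k
  have hJinv : ContinuousAt (fun x => (J x)⁻¹) p :=
    ContinuousAt.comp (f := J) (g := fun A => A⁻¹)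
      (continuousAt_matrix_inv _ (by
        simpa using continuousAt_inv₀ hsimple)) hJc
  let R : (Fin (n+2) → ℝ) × (Fin (n+2) → Fin (n+2) → ℝ) → Matrix (Fin (n+2)) (Fin (n+2)) ℝ :=
    fun z => Matrix.of fun k c => ∑ l, (U * (J z.1)⁻¹) k l * J (z.2 k) l c
  have hterm : ∀ k c l, ContinuousAt
      (fun z : (Fin (n+2) → ℝ) × (Fin (n+2) → Fin (n+2) → ℝ) =>
        (U * (J z.1)⁻¹) k l * J (z.2 k) l c) (p, fun _ => p) := by
    intro k c l
    refine ContinuousAt.mul ?_ ?_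
    · have h1 : ContinuousAt (fun x => (U * (J x)⁻¹) k l) p :=
        ContinuousAt.comp (f := fun x => (J x)⁻¹) (g := fun A => (U * A) k l)
          (by fun_prop) hJinv
      exact h1.comp_of_eq (x := (p, fun _ => p)) continuousAt_fst rfl
    · exact (continuousAt_pd hΩ (hC1 l) hp c).comp_of_eq
        (f := fun z : (Fin (n+2) → ℝ) × (Fin (n+2) → Fin (n+2) → ℝ) => z.2 k)
        (x := (p, fun _ => p)) (by fun_prop) rfl
  have hR : ContinuousAt R (p, fun _ => p) :=
    continuousAt_pi.2 fun k => continuousAt_pi.2 fun c => by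
      have := tendsto_finsetSum Finset.univ fun l _ => hterm k c l
      exact this
  have hRp : R (p, fun _ => p) = U := by
    change U * (J p)⁻¹ * J p = U
    rw [Matrix.mul_assoc, Matrix.nonsing_inv_mul _ (isUnit_iff_ne_zero.2 hsimple), Matrix.mul_one]
  have hsign := hR.eventually (by rw [hRp]; exact hU.eventually_signedMinor_mul_pos)
  have hdet : ∀ᶠ z : (Fin (n+2) → ℝ) × (Fin (n+2) → Fin (n+2) → ℝ) in 𝓝 (p, fun _ => p),
      (J z.1).det ≠ 0 :=
    (continuousAt_fst (p := (p, fun _ => p))).eventually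
      ((ContinuousAt.comp (g := Matrix.det) (by fun_prop) hJc).eventually_ne hsimple)
  obtain ⟨δ, hδ, hball⟩ := Metric.eventually_nhds_iff.1 (hdet.and hsign)
  refine ⟨δ, hδ, fun a b hab hpB hBΩ hsize => ?_⟩
  have hdist : ∀ x ∈ Set.Icc a b, dist x p < δ := fun x hx =>
    (dist_pi_lt_iff hδ).2 fun i =>
      (Real.dist_le_of_mem_Icc ⟨hx.1 i, hx.2 i⟩ ⟨hpB.1 i, hpB.2 i⟩).trans_lt (hsize i)
  have hm : (fun i => (a i + b i) / 2) ∈ Set.Icc a b :=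
    ⟨fun i => by linarith [hab i], fun i => by linarith [hab i]⟩
  have hB : ∀ q : Fin (n+2) → Fin (n+2) → ℝ, (∀ k, q k ∈ Set.Icc a b) →
      dist ((fun i => (a i + b i) / 2 : Fin (n+2) → ℝ), q) (p, fun _ => p) < δ := fun q hq =>
    max_lt (hdist _ hm) ((dist_pi_lt_iff hδ).2 fun k => hdist _ (hq k))
  refine ⟨(Matrix.isUnit_iff_isUnit_det _).2
    (isUnit_iff_ne_zero.2 (hball (hB _ fun _ => hpB)).1), ?_⟩
  refine OMSystem.of_signedMinor ⟨p, hpB⟩ (s := signedMinor n 0 U) fun q hq i => ?_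
  have hGR : (Matrix.of fun k c => pd (fun x => ∑ l,
      (U * (J fun i => (a i + b i) / 2)⁻¹) k l * f l x) c (q k)) =
      R ((fun i => (a i + b i) / 2), q) := by
    ext k c
    exact pd_sum_mul (fun l => ((hC1 l).differentiableOn one_ne_zero).differentiableAt
      (hΩ.mem_nhds (hBΩ (hq k)))) _ c
  exact hGR ▸ (hball (hB q hq)).2 i
end

section
/- Every real n×n O-M matrix (n ≥ 2) has nonzero determinant; consequently the O-M condition implies the hypothesis of the Jacobian test. -/
/-- Every O-M matrix has nonzero determinant. -/
theorem OMMatrix.det_ne_zero (n : ℕ) (U : Matrix (Fin (n+2)) (Fin (n+2)) ℝ)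
    (hU : OMMatrix n U) : U.det ≠ 0 := by
  have hpos : 0 < U.det * ((-1 : ℝ) ^ (((0 : Fin (n+2)) : ℕ) + n + 1) *
      (U.submatrix Fin.castSucc (0 : Fin (n+2)).succAbove).det * U (Fin.last (n+1)) 0) := by
    rw [Matrix.det_succ_row U (Fin.last (n+1)), Finset.sum_mul]
    refine Finset.sum_pos (fun j _ => ?_) Finset.univ_nonempty
    refine (hU j 0).trans_eq (congrArg (· * _) ?_)
    rw [Fin.succAbove_last, Fin.val_last]
    ring
  exact left_ne_zero_of_mul hpos.ne'
end
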